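/- Let X, Y be finite disjoint sets, Z ⊆ Y, and Q ∈ 𝔓(Z). The mapping τ_{X,Y} induces a self-inverse bijection between 𝔘(X,Y) ∩ ℭ_Q(X ∪ (Y\Z), Z) and 𝔘(X,Y) ∩ ℭ_{Q^d}(X ∪ (Y\Z), Z); in particular, for Z = Y, it induces a self-inverse bijection between 𝔐_Q(X,Y) and 𝔐_{Q^d}(X,Y). -/

import Mathlib

namespace Erne

variable {α : Type*}

/-- A partial order relation with carrier `X`: a reflexive, antisymmetric,
transitive subset of `X × X`. -/
def IsPor (X : Set α) (R : Set (α × α)) : Prop :=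
  R ⊆ X ×ˢ X ∧ (∀ x ∈ X, (x, x) ∈ R) ∧
    (∀ x y, (x, y) ∈ R → (y, x) ∈ R → x = y) ∧
    (∀ x y z, (x, y) ∈ R → (y, z) ∈ R → (x, z) ∈ R)

/-- The carrier of a p.o.r. (recovered from reflexivity). -/
def carrier (R : Set (α × α)) : Set α := {x | (x, x) ∈ R}

/-- The induced p.o.r. `R|_M = R ∩ (M × M)`. -/
def restrict (R : Set (α × α)) (M : Set α) : Set (α × α) := R ∩ M ×ˢ M

/-- The dual `R^d`. -/
def dual (R : Set (α × α)) : Set (α × α) := {p | (p.2, p.1) ∈ R}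

/-- `↑_R M`. -/
def upSet (R : Set (α × α)) (M : Set α) : Set α := {x | ∃ y ∈ M, (y, x) ∈ R}

/-- `↓_R M`. -/
def downSet (R : Set (α × α)) (M : Set α) : Set α := {x | ∃ y ∈ M, (x, y) ∈ R}

/-- `↑_R x`. -/
def up (R : Set (α × α)) (x : α) : Set α := {z | (x, z) ∈ R}

/-- `↓_R y`. -/
def down (R : Set (α × α)) (y : α) : Set α := {x | (x, y) ∈ R}

/-- `L` is a lower end of `R`. -/
def IsLowerEnd (R : Set (α × α)) (L : Set α) : Prop :=
  ∀ x y, (x, y) ∈ R → y ∈ L → x ∈ L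

/-- `U` is an upper end of `R`. -/
def IsUpperEnd (R : Set (α × α)) (U : Set α) : Prop :=
  ∀ x y, (x, y) ∈ R → x ∈ U → y ∈ U

/-- `M` is convex in `R`. -/
def IsConvex (R : Set (α × α)) (M : Set α) : Prop :=
  ∀ a b x, a ∈ M → b ∈ M → (a, x) ∈ R → (x, b) ∈ R → x ∈ M

/-- The set of maximal points of `R`: those `x` with `↑_R x = {x}`. -/
def maxPts (R : Set (α × α)) : Set α := {x | up R x = {x}}

/-- `max M = max R|_M`. -/
def maxOf (R : Set (α × α)) (M : Set α) : Set α := maxPts (restrict R M)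

/-- `γ_R(M) = ⋃_{(m,n) ∈ M×M} (↑_R m) ∩ (↓_R n)`, the convex hull of `M` in `R`. -/
def gamma (R : Set (α × α)) (M : Set α) : Set α :=
  {x | ∃ m ∈ M, ∃ n ∈ M, (m, x) ∈ R ∧ (x, n) ∈ R}

/-- The antichain (diagonal) `Δ_Y` on `Y`. -/
def diag (Y : Set α) : Set (α × α) := {p | p.1 = p.2 ∧ p.1 ∈ Y}

/-- `𝔘(X,Y)`: p.o.r.'s on `X ∪ Y` in which `Y` is an upper end. -/
def Uset (X Y : Set α) : Set (Set (α × α)) :=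
  {R | IsPor (X ∪ Y) R ∧ IsUpperEnd R Y}

/-- `ℭ_Q(X,Y)`: p.o.r.'s on `X ∪ Y` with `R|_Y = Q` convex in `R`. -/
def Cset (Q : Set (α × α)) (X Y : Set α) : Set (Set (α × α)) :=
  {R | IsPor (X ∪ Y) R ∧ restrict R Y = Q ∧ IsConvex R Y}

/-- `𝔐_Q(X,Y) = 𝔘(X,Y) ∩ ℭ_Q(X,Y)`. -/
def Mset (Q : Set (α × α)) (X Y : Set α) : Set (Set (α × α)) :=
  Uset X Y ∩ Cset Q X Y

/-- `𝔐*_Q(X,Y)`: members of `ℭ_Q(X,Y)` with `max Q = max R`. -/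
def MstarSet (Q : Set (α × α)) (X Y : Set α) : Set (Set (α × α)) :=
  {R ∈ Cset Q X Y | maxPts Q = maxPts R}

/-- `ℑ_Q(X,Y)`: p.o.r.'s on `X ∪ Y` with `R|_Y = Q`. -/
def Iset (Q : Set (α × α)) (X Y : Set α) : Set (Set (α × α)) :=
  {R | IsPor (X ∪ Y) R ∧ restrict R Y = Q}

/-- `𝔑*_Q(X,Y)`: members of `ℑ_Q(X,Y)` with `max Q = max R`. -/
def NstarSet (Q : Set (α × α)) (X Y : Set α) : Set (Set (α × α)) :=
  {R ∈ Iset Q X Y | maxPts Q = maxPts R}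

/-- `τ_{X,Y}(R) = (R|_X)^d ∪ ((X×Y) \ R) ∪ (R|_Y)^d`. -/
def tau (X Y : Set α) (R : Set (α × α)) : Set (α × α) :=
  dual (restrict R X) ∪ ((X ×ˢ Y) \ R) ∪ dual (restrict R Y)

/-- `𝒢_Q(M)`: members `G` of `ℑ_Q(M,Y)` with `γ_G(Y) = c(G)`. -/
def GsetM (Q : Set (α × α)) (Y M : Set α) : Set (Set (α × α)) :=
  {G ∈ Iset Q M Y | gamma G Y = carrier G}

/-- `𝔊_Q(X) = ⋃_{M ⊆ X} 𝒢_Q(M)`. -/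
def Gset (Q : Set (α × α)) (X Y : Set α) : Set (Set (α × α)) :=
  {G | ∃ M ⊆ X, G ∈ GsetM Q Y M}

/-- `ℒ(P)`: the lower ends of `P` (subsets of the carrier of `P`). -/
def lowerEnds (P : Set (α × α)) : Set (Set α) :=
  {L | L ⊆ carrier P ∧ IsLowerEnd P L}

/-- `ℋ_Q(Y, ℒ(P))`: mappings `f : Y → ℒ(P)` with `(a,b) ∈ Q → f a ⊆ f b`. -/
def Hset (Q P : Set (α × α)) (Y : Set α) : Set (↥Y → Set α) :=
  {f | (∀ y, f y ∈ lowerEnds P) ∧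
    ∀ a b : ↥Y, ((a : α), (b : α)) ∈ Q → f a ⊆ f b}

/-- `Φ(f) = P ∪ Q ∪ ⋃_{y ∈ Y} (f(y) × {y})` for `f ∈ ℋ_Q(Y, ℒ(P))`. -/
def Phi (Q : Set (α × α)) (Y : Set α) (P : Set (α × α)) (f : ↥Y → Set α) :
    Set (α × α) :=
  P ∪ Q ∪ {p | ∃ h : p.2 ∈ Y, p.1 ∈ f ⟨p.2, h⟩}

/-- `𝔉_Q(X,Y)`: pairs `(P, f)` with `P ∈ 𝔓(X)` and `f ∈ ℋ_Q(Y, ℒ(P))`;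
the first component encodes `S(f) = P`. -/
def Fset (Q : Set (α × α)) (X Y : Set α) :
    Set (Set (α × α) × (↥Y → Set α)) :=
  {pf | IsPor X pf.1 ∧ pf.2 ∈ Hset Q pf.1 Y}

/-- `𝔉*_Q(X,Y)`: those `f ∈ 𝔉_Q(X,Y)` with `X = ⋃_{y ∈ Y} f(y)`. -/
def FstarSet (Q : Set (α × α)) (X Y : Set α) :
    Set (Set (α × α) × (↥Y → Set α)) :=
  {pf ∈ Fset Q X Y | X = ⋃ y : ↥Y, pf.2 y}

/-- The transitive hull of `S`: the smallest transitive relation containing `S`. -/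
def transHull (S : Set (α × α)) : Set (α × α) :=
  {p | Relation.TransGen (fun a b => (a, b) ∈ S) p.1 p.2}

theorem mem_tau {X Y : Set α} {R : Set (α × α)} {x y : α} :
    (x, y) ∈ tau X Y R ↔ (x ∈ X ∧ y ∈ X ∧ (y, x) ∈ R) ∨
      (x ∈ X ∧ y ∈ Y ∧ (x, y) ∉ R) ∨ (x ∈ Y ∧ y ∈ Y ∧ (y, x) ∈ R) := by
  simp only [tau, dual, restrict, Set.mem_union, Set.mem_sdiff, Set.mem_inter_iff,
    Set.mem_prod, Set.mem_ofPred_eq]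
  tauto

theorem tau_mem_Uset {X Y : Set α} (hXY : Disjoint X Y) {R : Set (α × α)}
    (hR : R ∈ Uset X Y) : tau X Y R ∈ Uset X Y := by
  obtain ⟨⟨-, hrefl, hanti, htrans⟩, -⟩ := hR
  have hdisj : ∀ a, a ∈ X → a ∉ Y := fun _ h => Set.disjoint_left.mp hXY h
  refine ⟨⟨?_, ?_, ?_, ?_⟩, ?_⟩
  · rintro ⟨x, y⟩ h
    rw [mem_tau] at h
    simp only [Set.mem_prod, Set.mem_union]
    tauto
  · intro x hx
    have := hrefl x hx
    rw [mem_tau]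
    rcases hx with hx | hx <;> tauto
  · intro x y h₁ h₂
    rw [mem_tau] at h₁ h₂
    grind
  · intro x y z h₁ h₂
    rw [mem_tau] at h₁ h₂ ⊢
    grind
  · intro x y h hx
    rw [mem_tau] at h
    grind

theorem tau_tau {X Y : Set α} (hXY : Disjoint X Y) {R : Set (α × α)}
    (hR : R ∈ Uset X Y) : tau X Y (tau X Y R) = R := by
  obtain ⟨⟨hsub, -⟩, hup⟩ := hR
  have hdisj : ∀ a, a ∈ X → a ∉ Y := fun _ h => Set.disjoint_left.mp hXY h
  ext ⟨x, y⟩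
  have hxy : (x, y) ∈ R → (x ∈ X ∨ x ∈ Y) ∧ (y ∈ X ∨ y ∈ Y) := fun h => hsub h
  have := hup x y
  simp only [mem_tau]
  grind

theorem restrict_tau {X Y Z : Set α} (hXY : Disjoint X Y) (hZY : Z ⊆ Y)
    (R : Set (α × α)) : restrict (tau X Y R) Z = dual (restrict R Z) := by
  have hdisj : ∀ a, a ∈ X → a ∉ Y := fun _ h => Set.disjoint_left.mp hXY h
  ext ⟨x, y⟩
  have hx := @hZY x
  have hy := @hZY y
  simp only [restrict, dual, Set.mem_inter_iff, Set.mem_prod, Set.mem_ofPred_eq, mem_tau]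
  grind

theorem isConvex_tau {X Y Z : Set α} (hXY : Disjoint X Y) (hZY : Z ⊆ Y)
    {R : Set (α × α)} (hR : IsConvex R Z) : IsConvex (tau X Y R) Z := by
  have hdisj : ∀ a, a ∈ X → a ∉ Y := fun _ h => Set.disjoint_left.mp hXY h
  intro a b x ha hb h₁ h₂
  have ha' := hZY ha
  rw [mem_tau] at h₁ h₂
  have := hR b a x hb ha
  grind

theorem mapsTo_tau {X Y Z : Set α} (hXY : Disjoint X Y) (hZY : Z ⊆ Y)
    (Q : Set (α × α)) :
    Set.MapsTo (tau X Y) (Uset X Y ∩ Cset Q (X ∪ (Y \ Z)) Z)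
      (Uset X Y ∩ Cset (dual Q) (X ∪ (Y \ Z)) Z) := by
  rintro R ⟨hU, -, hQ, hconv⟩
  have hU' := tau_mem_Uset hXY hU
  refine ⟨hU', ?_, ?_, isConvex_tau hXY hZY hconv⟩
  · rw [Set.union_assoc, Set.sdiff_union_of_subset hZY]
    exact hU'.1
  · rw [restrict_tau hXY hZY, hQ]

theorem bijOn_tau {X Y Z : Set α} (hXY : Disjoint X Y) (hZY : Z ⊆ Y)
    (Q : Set (α × α)) :
    Set.BijOn (tau X Y) (Uset X Y ∩ Cset Q (X ∪ (Y \ Z)) Z)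
      (Uset X Y ∩ Cset (dual Q) (X ∪ (Y \ Z)) Z) :=
  Set.InvOn.bijOn ⟨fun _ hR => tau_tau hXY hR.1, fun _ hR => tau_tau hXY hR.1⟩
    (mapsTo_tau hXY hZY Q) (mapsTo_tau hXY hZY (dual Q))

/-- `τ_{X,Y}` induces a self-inverse bijection between
`𝔘(X,Y) ∩ ℭ_Q(X ∪ (Y\Z), Z)` and `𝔘(X,Y) ∩ ℭ_{Q^d}(X ∪ (Y\Z), Z)`;
in particular, for `Z = Y`, between `𝔐_Q(X,Y)` and `𝔐_{Q^d}(X,Y)`. -/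
theorem stmt10 {α : Type*} (X Y : Set α) (hX : X.Finite) (hY : Y.Finite)
    (hXY : Disjoint X Y) (Z : Set α) (hZY : Z ⊆ Y) (Q : Set (α × α))
    (hQ : IsPor Z Q) :
    Set.BijOn (tau X Y) (Uset X Y ∩ Cset Q (X ∪ (Y \ Z)) Z)
      (Uset X Y ∩ Cset (dual Q) (X ∪ (Y \ Z)) Z) ∧
    (∀ R ∈ Uset X Y ∩ Cset Q (X ∪ (Y \ Z)) Z, tau X Y (tau X Y R) = R) ∧
    (Z = Y → Set.BijOn (tau X Y) (Mset Q X Y) (Mset (dual Q) X Y)) := by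
  refine ⟨bijOn_tau hXY hZY Q, fun R hR => tau_tau hXY hR.1, ?_⟩
  rintro rfl
  simpa [Mset] using bijOn_tau hXY hZY Q

end Erne
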